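/- Let P be a penny configuration in general position and let A ∈ P have degree exactly 4 with unit-neighbors B₁, B₂, B₃, B₄, where B₁ and B₂ are consecutive in the cyclic angular order of B₁, B₂, B₃, B₄ around A. Suppose that for each i ∈ {1,2}: Bᵢ has degree exactly 5, Bᵢ is popular, no unit-neighbor of Bᵢ other than A is at distance exactly 1 from A, and the four unit-neighbors of Bᵢ other than A can be split into two pairs with the two points of each pair at distance exactly 1 from each other (i.e., the edge ABᵢ is of Type I). Then this situation is impossible (a contradiction follows). -/

import Mathlib

open Real EuclideanGeometry

/-- The Euclidean plane. -/
abbrev Pt := EuclideanSpace ℝ (Fin 2)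

/-- A penny configuration in general position: a finite set of points in the plane
such that any two distinct points are at distance at least 1 and no three points
are collinear. -/
def PennyGP (P : Finset Pt) : Prop :=
  (∀ p ∈ P, ∀ q ∈ P, p ≠ q → 1 ≤ dist p q) ∧
  (∀ p ∈ P, ∀ q ∈ P, ∀ r ∈ P, p ≠ q → p ≠ r → q ≠ r →
    ¬ Collinear ℝ ({p, q, r} : Set Pt))

/-- The degree of a point `A` in the penny graph of `P`: the number of points of `P`
at distance exactly 1 from `A`. -/
noncomputable def deg (P : Finset Pt) (A : Pt) : ℕ :=
  {q : Pt | q ∈ P ∧ dist A q = 1}.ncard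

/-- The points of the list `ws` occur in this exact cyclic angular order around `X`,
in the counterclockwise direction: each point lies on a ray from `X` at angle `θ i`,
where the angles are strictly increasing and all lie within one turn. (The cyclic
angular order of points around `X` in a given rotational direction is witnessed by
such a list of angles, cut at an arbitrary reference ray.) -/
def AngOrder (X : Pt) (ws : List Pt) : Prop :=
  ∃ θ : Fin ws.length → ℝ, ∃ r : Fin ws.length → ℝ,
    (∀ i, 0 < r i) ∧ StrictMono θ ∧
    (∀ i j : Fin ws.length, θ j - θ i < 2 * π) ∧
    ∀ i : Fin ws.length,
      ws.get i = X + r i • (EuclideanSpace.equiv (Fin 2) ℝ).symm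
        ![Real.cos (θ i), Real.sin (θ i)]

/-- A point `B ∈ P` is unpopular if `deg B ≤ 4`, or `deg B = 5` and some
unit-neighbor of `B` has degree at most 3, or `deg B = 5` and at least two
unit-neighbors of `B` have degree 4. Otherwise it is popular. -/
def Unpopular (P : Finset Pt) (B : Pt) : Prop :=
  deg P B ≤ 4 ∨
  (deg P B = 5 ∧ ∃ C ∈ P, dist B C = 1 ∧ deg P C ≤ 3) ∨
  (deg P B = 5 ∧ ∃ C ∈ P, ∃ C' ∈ P, C ≠ C' ∧ dist B C = 1 ∧ dist B C' = 1 ∧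
    deg P C = 4 ∧ deg P C' = 4)

/-- The unit vector in direction `θ`. -/
noncomputable def unitVec (θ : ℝ) : Pt := !₂[Real.cos θ, Real.sin θ]

/-- A parametrization of the unit circle by angle, with arbitrary origin and orientation. -/
def IsAngleParam (u : ℝ → Pt) : Prop :=
  ∃ c σ : ℝ, (σ = 1 ∨ σ = -1) ∧ ∀ t, u t = unitVec (c + σ * t)

lemma isAngleParam_add (c : ℝ) : IsAngleParam fun t => unitVec (c + t) :=
  ⟨c, 1, Or.inl rfl, fun t => by simp⟩

lemma isAngleParam_sub (c : ℝ) : IsAngleParam fun t => unitVec (c - t) :=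
  ⟨c, -1, Or.inr rfl, fun t => by simp [sub_eq_add_neg]⟩

lemma IsAngleParam.neg {u : ℝ → Pt} (hu : IsAngleParam u) : IsAngleParam fun t => u (-t) := by
  obtain ⟨c, σ, hσ, h⟩ := hu
  refine ⟨c, -σ, ?_, fun t => by simp only [h]; congr 1; ring⟩
  rcases hσ with rfl | rfl <;> simp

lemma dist_sq_eq_coords (p q : Pt) : dist p q ^ 2 = (p 0 - q 0) ^ 2 + (p 1 - q 1) ^ 2 := by
  rw [EuclideanSpace.dist_eq, Real.sq_sqrt (by positivity)]
  simp [Fin.sum_univ_two, Real.dist_eq, sq_abs]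

lemma unitVec_add_pi (t : ℝ) : unitVec (t + π) = -unitVec t := by
  ext i; fin_cases i <;> simp [unitVec]

lemma unitVec_add_two_pi (t : ℝ) : unitVec (t + 2 * π) = unitVec t := by
  ext i; fin_cases i <;> simp [unitVec]

lemma cos_two_pi_div_three : Real.cos (2 * π / 3) = -1 / 2 := by
  rw [show 2 * π / 3 = π - π / 3 by ring, Real.cos_pi_sub, Real.cos_pi_div_three]; ring

lemma sin_two_pi_div_three : Real.sin (2 * π / 3) = √3 / 2 := by
  rw [show 2 * π / 3 = π - π / 3 by ring, Real.sin_pi_sub, Real.sin_pi_div_three]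

lemma unitVec_add_pi_div_three (t : ℝ) :
    unitVec (t + π / 3) = unitVec t + unitVec (t + 2 * π / 3) := by
  ext i; fin_cases i <;>
    simp [unitVec, Real.cos_add, Real.sin_add, cos_two_pi_div_three, sin_two_pi_div_three] <;> ring

lemma unitVec_sub_pi (t : ℝ) : unitVec (t - π) = -unitVec t := by
  ext i; fin_cases i <;> simp [unitVec]

lemma unitVec_sub_two_pi (t : ℝ) : unitVec (t - 2 * π) = unitVec t := by
  ext i; fin_cases i <;> simp [unitVec]

lemma unitVec_sub_pi_div_three (t : ℝ) :
    unitVec (t - π / 3) = unitVec t + unitVec (t - 2 * π / 3) := by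
  ext i; fin_cases i <;>
    simp [unitVec, Real.cos_sub, Real.sin_sub, cos_two_pi_div_three, sin_two_pi_div_three] <;> ring

namespace IsAngleParam

variable {u : ℝ → Pt}

lemma add_pi (hu : IsAngleParam u) (t : ℝ) : u (t + π) = -u t := by
  obtain ⟨c, σ, rfl | rfl, h⟩ := hu
  · rw [h, h, ← unitVec_add_pi]; congr 1; ring
  · rw [h, h, ← unitVec_sub_pi]; congr 1; ring

lemma add_pi_div_three (hu : IsAngleParam u) (t : ℝ) :
    u (t + π / 3) = u t + u (t + 2 * π / 3) := by
  obtain ⟨c, σ, rfl | rfl, h⟩ := hu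
  · rw [h, h, h, show c + 1 * (t + π / 3) = c + 1 * t + π / 3 by ring,
      show c + 1 * (t + 2 * π / 3) = c + 1 * t + 2 * π / 3 by ring, unitVec_add_pi_div_three]
  · rw [h, h, h, show c + -1 * (t + π / 3) = c + -1 * t - π / 3 by ring,
      show c + -1 * (t + 2 * π / 3) = c + -1 * t - 2 * π / 3 by ring, unitVec_sub_pi_div_three]

lemma dist_sq (hu : IsAngleParam u) (X : Pt) (s t : ℝ) :
    dist (X + u s) (X + u t) ^ 2 = 2 - 2 * Real.cos (s - t) := by
  obtain ⟨c, σ, hσ, h⟩ := hu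
  have : Real.cos (s - t) = Real.cos ((c + σ * s) - (c + σ * t)) := by
    rcases hσ with rfl | rfl
    · congr 1; ring
    · rw [← Real.cos_neg]; congr 1; ring
  rw [dist_sq_eq_coords, this, h, h, Real.cos_sub]
  simp only [unitVec, PiLp.add_apply, Matrix.cons_val_zero, Matrix.cons_val_one,
    Matrix.cons_val_fin_one]
  linear_combination Real.sin_sq_add_cos_sq (c + σ * s) + Real.sin_sq_add_cos_sq (c + σ * t)

lemma dist_base (hu : IsAngleParam u) (X : Pt) (t : ℝ) : dist X (X + u t) = 1 := by
  have : dist X (X + u t) ^ 2 = 1 := by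
    obtain ⟨c, σ, hσ, h⟩ := hu
    rw [dist_sq_eq_coords, h]
    simp [unitVec]
  nlinarith [dist_nonneg (x := X) (y := X + u t)]

lemma exists_eq (hu : IsAngleParam u) {X Y : Pt} (h : dist X Y = 1) (a : ℝ) :
    ∃ t, a ≤ t ∧ t < a + 2 * π ∧ Y = X + u t := by
  have h2 : (Y 0 - X 0) ^ 2 + (Y 1 - X 1) ^ 2 = 1 := by
    have := dist_sq_eq_coords X Y
    rw [h] at this; linarith
  obtain ⟨θ, h0, h1⟩ : ∃ θ : ℝ, Real.cos θ = Y 0 - X 0 ∧ Real.sin θ = Y 1 - X 1 := by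
    have hn : ‖(⟨Y 0 - X 0, Y 1 - X 1⟩ : ℂ)‖ = 1 := by
      rw [Complex.norm_def, Complex.normSq_mk, ← sq, ← sq, h2, Real.sqrt_one]
    have hz : (⟨Y 0 - X 0, Y 1 - X 1⟩ : ℂ) ≠ 0 := by
      intro hz; rw [hz] at hn; simp at hn
    refine ⟨Complex.arg ⟨Y 0 - X 0, Y 1 - X 1⟩, ?_, ?_⟩
    · rw [Complex.cos_arg hz, hn, div_one]
    · rw [Complex.sin_arg, hn, div_one]
  have hY : Y = X + unitVec θ := by
    ext i; fin_cases i <;> simp [unitVec, h0, h1]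
  obtain ⟨c, σ, hσ, hc⟩ := hu
  have hp : (0 : ℝ) < 2 * π := by positivity
  obtain ⟨t, ⟨ht1, ht2⟩, n, hn⟩ : ∃ t, (a ≤ t ∧ t < a + 2 * π) ∧
      ∃ n : ℤ, t = σ * (θ - c) + n * (2 * π) := by
    refine ⟨toIcoMod hp a (σ * (θ - c)), toIcoMod_mem_Ico hp a _,
      -toIcoDiv hp a (σ * (θ - c)), ?_⟩
    rw [toIcoMod, zsmul_eq_mul]; push_cast; ring
  refine ⟨t, ht1, ht2, ?_⟩
  rw [hY, hc, hn]
  congr 1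
  rcases hσ with rfl | rfl
  · rw [show c + 1 * (1 * (θ - c) + n * (2 * π)) = θ + n * (2 * π) by ring]
    simp [unitVec, Real.cos_add_int_mul_two_pi, Real.sin_add_int_mul_two_pi]
  · rw [show c + -1 * (-1 * (θ - c) + n * (2 * π)) = θ - n * (2 * π) by ring]
    simp [unitVec, Real.cos_sub_int_mul_two_pi, Real.sin_sub_int_mul_two_pi]

lemma trapezoid_dist_sq (hu : IsAngleParam u) (X : Pt) (s p q : ℝ) :
    dist (X + u s + u (s + p)) (X + u (s + q)) ^ 2 =
      1 + 8 * Real.cos (p / 2) * Real.sin (q / 2) * Real.sin ((q - p) / 2) := by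
  have key : ∀ c p q : ℝ, (Real.cos c + Real.cos (c + p) - Real.cos (c + q)) ^ 2 +
      (Real.sin c + Real.sin (c + p) - Real.sin (c + q)) ^ 2 =
      1 + 8 * Real.cos (p / 2) * Real.sin (q / 2) * Real.sin ((q - p) / 2) := by
    intro c p q
    obtain ⟨a, rfl⟩ : ∃ a, p = 2 * a := ⟨p / 2, by ring⟩
    obtain ⟨b, rfl⟩ : ∃ b, q = 2 * b := ⟨q / 2, by ring⟩
    have hc := Real.sin_sq_add_cos_sq c
    have ha := Real.sin_sq_add_cos_sq a
    have hb := Real.sin_sq_add_cos_sq b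
    rw [show 2 * a / 2 = a by ring, show 2 * b / 2 = b by ring,
      show (2 * b - 2 * a) / 2 = b - a by ring, Real.sin_sub]
    simp only [Real.cos_add, Real.sin_add, Real.cos_two_mul, Real.sin_two_mul]
    generalize Real.sin c = sc, Real.cos c = cc, Real.sin a = sa, Real.cos a = ca,
      Real.sin b = sb, Real.cos b = cb at *
    have hca : ca ^ 2 = 1 - sa ^ 2 := by linarith
    have hcb : cb ^ 2 = 1 - sb ^ 2 := by linarith
    have hcc : cc ^ 2 = 1 - sc ^ 2 := by linarith
    grind
  obtain ⟨c, σ, hσ, h⟩ := hu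
  rw [dist_sq_eq_coords, h, h, h]
  simp only [unitVec, PiLp.add_apply, Matrix.cons_val_zero, Matrix.cons_val_one,
    Matrix.cons_val_fin_one]
  have := key (c + σ * s) (σ * p) (σ * q)
  rw [show c + σ * s + σ * p = c + σ * (s + p) by ring,
    show c + σ * s + σ * q = c + σ * (s + q) by ring] at this
  have h2 : Real.cos (σ * p / 2) * Real.sin (σ * q / 2) * Real.sin ((σ * q - σ * p) / 2) =
      Real.cos (p / 2) * Real.sin (q / 2) * Real.sin ((q - p) / 2) := by
    rcases hσ with rfl | rfl
    · simp
    · rw [show -1 * p / 2 = -(p / 2) by ring, show -1 * q / 2 = -(q / 2) by ring,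
        show (-1 * q - -1 * p) / 2 = -((q - p) / 2) by ring, Real.cos_neg, Real.sin_neg,
        Real.sin_neg]
      ring
  linear_combination this + 8 * h2

lemma pentagon_dist_sq (hu : IsAngleParam u) (X : Pt) (s α ω β : ℝ) :
    dist (X + u s + u (s + (α + ω))) (X + u (s + (α + ω + β)) + u (s + α)) ^ 2 =
      4 * (Real.sin (α / 2) ^ 2 + Real.sin (β / 2) ^ 2 +
        2 * Real.sin (α / 2) * Real.sin (β / 2) * Real.cos (ω + (α + β) / 2)) := by
  have key : ∀ c a w b : ℝ, (Real.cos c + Real.cos (c + (2 * a + w))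
        - Real.cos (c + (2 * a + w + 2 * b)) - Real.cos (c + 2 * a)) ^ 2 +
      (Real.sin c + Real.sin (c + (2 * a + w))
        - Real.sin (c + (2 * a + w + 2 * b)) - Real.sin (c + 2 * a)) ^ 2 =
      4 * (Real.sin a ^ 2 + Real.sin b ^ 2 +
        2 * Real.sin a * Real.sin b * Real.cos (w + (a + b))) := by
    intro c a w b
    have e1 : Real.cos c - Real.cos (c + 2 * a) = 2 * Real.sin a * Real.sin (c + a) := by
      rw [Real.cos_sub_cos, show (c + (c + 2 * a)) / 2 = c + a by ring,
        show (c - (c + 2 * a)) / 2 = -a by ring, Real.sin_neg]; ring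
    have e2 : Real.cos (c + (2 * a + w)) - Real.cos (c + (2 * a + w + 2 * b)) =
        2 * Real.sin b * Real.sin (c + a + (w + (a + b))) := by
      rw [Real.cos_sub_cos, show (c + (2 * a + w) + (c + (2 * a + w + 2 * b))) / 2 =
        c + a + (w + (a + b)) by ring,
        show (c + (2 * a + w) - (c + (2 * a + w + 2 * b))) / 2 = -b by ring, Real.sin_neg]; ring
    have e3 : Real.sin c - Real.sin (c + 2 * a) = -2 * Real.sin a * Real.cos (c + a) := by
      rw [Real.sin_sub_sin, show (c + (c + 2 * a)) / 2 = c + a by ring,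
        show (c - (c + 2 * a)) / 2 = -a by ring, Real.sin_neg]; ring
    have e4 : Real.sin (c + (2 * a + w)) - Real.sin (c + (2 * a + w + 2 * b)) =
        -2 * Real.sin b * Real.cos (c + a + (w + (a + b))) := by
      rw [Real.sin_sub_sin, show (c + (2 * a + w) + (c + (2 * a + w + 2 * b))) / 2 =
        c + a + (w + (a + b)) by ring,
        show (c + (2 * a + w) - (c + (2 * a + w + 2 * b))) / 2 = -b by ring, Real.sin_neg]; ring
    have e5 : Real.cos (w + (a + b)) = Real.cos (c + a + (w + (a + b))) * Real.cos (c + a) +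
        Real.sin (c + a + (w + (a + b))) * Real.sin (c + a) := by
      rw [← Real.cos_sub]; congr 1; ring
    have h1 := Real.sin_sq_add_cos_sq (c + a)
    have h2 := Real.sin_sq_add_cos_sq (c + a + (w + (a + b)))
    rw [e5, show ∀ x y z t : ℝ, x + y - z - t = (x - t) + (y - z) by intros; ring, e1, e2,
      show ∀ x y z t : ℝ, x + y - z - t = (x - t) + (y - z) by intros; ring, e3, e4]
    linear_combination 4 * Real.sin a ^ 2 * h1 + 4 * Real.sin b ^ 2 * h2
  obtain ⟨c, σ, hσ, h⟩ := hu
  rw [dist_sq_eq_coords, h, h, h, h]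
  simp only [unitVec, PiLp.add_apply, Matrix.cons_val_zero, Matrix.cons_val_one,
    Matrix.cons_val_fin_one]
  have := key (c + σ * s) (σ * (α / 2)) (σ * ω) (σ * (β / 2))
  rw [show c + σ * s + (2 * (σ * (α / 2)) + σ * ω) = c + σ * (s + (α + ω)) by ring,
    show c + σ * s + (2 * (σ * (α / 2)) + σ * ω + 2 * (σ * (β / 2))) =
      c + σ * (s + (α + ω + β)) by ring,
    show c + σ * s + 2 * (σ * (α / 2)) = c + σ * (s + α) by ring,
    show σ * ω + (σ * (α / 2) + σ * (β / 2)) = σ * (ω + (α + β) / 2) by ring] at this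
  have h2 : 4 * (Real.sin (σ * (α / 2)) ^ 2 + Real.sin (σ * (β / 2)) ^ 2 +
        2 * Real.sin (σ * (α / 2)) * Real.sin (σ * (β / 2)) *
          Real.cos (σ * (ω + (α + β) / 2))) =
      4 * (Real.sin (α / 2) ^ 2 + Real.sin (β / 2) ^ 2 +
        2 * Real.sin (α / 2) * Real.sin (β / 2) * Real.cos (ω + (α + β) / 2)) := by
    rcases hσ with rfl | rfl
    · simp
    · simp only [neg_mul, one_mul, Real.sin_neg, Real.cos_neg]; ring
  linear_combination this + h2

/-- The free endpoints of a chain of four unit segments with interior angles `π - (α + ω)`,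
`α + ω + β`, `π - (ω + β)` are less than one apart. -/
lemma pentagon_dist_lt_one (hu : IsAngleParam u) (X : Pt) (s : ℝ) {α ω β : ℝ}
    (hα : 0 ≤ α) (hβ : 0 ≤ β) (hω : π / 3 ≤ ω) (hαω : α + ω < 2 * π / 3)
    (hωβ : ω + β < 2 * π / 3) :
    dist (X + u s + u (s + (α + ω))) (X + u (s + (α + ω + β)) + u (s + α)) < 1 := by
  have hsq := hu.pentagon_dist_sq X s α ω β
  have h60 := hu.pentagon_dist_sq X s α (π / 3) β
  have hpi := Real.pi_pos
  have e : X + u s + u (s + (α + π / 3)) - (X + u (s + (α + π / 3 + β)) + u (s + α)) =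
      X + u s + u (s + (α + 2 * π / 3)) - (X + u (s + (α + π / 3 + β))) := by
    have := hu.add_pi_div_three (s + α)
    rw [← add_assoc, this, show s + (α + 2 * π / 3) = s + α + 2 * π / 3 by ring]; abel
  rw [dist_eq_norm, e, ← dist_eq_norm, hu.trapezoid_dist_sq] at h60
  have c1 : 0 < Real.cos ((α + 2 * π / 3) / 2) :=
    Real.cos_pos_of_mem_Ioo ⟨by linarith, by linarith⟩
  have c2 : 0 < Real.sin ((α + π / 3 + β) / 2) :=
    Real.sin_pos_of_pos_of_lt_pi (by linarith) (by linarith)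
  have c3 : Real.sin ((α + π / 3 + β - (α + 2 * π / 3)) / 2) < 0 :=
    Real.sin_neg_of_neg_of_neg_pi_lt (by linarith) (by linarith)
  have c4 : 0 ≤ Real.sin (α / 2) := Real.sin_nonneg_of_nonneg_of_le_pi (by linarith) (by linarith)
  have c5 : 0 ≤ Real.sin (β / 2) := Real.sin_nonneg_of_nonneg_of_le_pi (by linarith) (by linarith)
  have c6 : Real.cos (ω + (α + β) / 2) ≤ Real.cos (π / 3 + (α + β) / 2) :=
    Real.cos_le_cos_of_nonneg_of_le_pi (by linarith) (by linarith) (by linarith)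
  have c7 := mul_le_mul_of_nonneg_left c6 (mul_nonneg c4 c5)
  have c8 := mul_neg_of_pos_of_neg (mul_pos c1 c2) c3
  have : dist (X + u s + u (s + (α + ω))) (X + u (s + (α + ω + β)) + u (s + α)) ^ 2 < 1 := by
    rw [hsq]; linarith
  nlinarith [dist_nonneg (x := X + u s + u (s + (α + ω)))
    (y := X + u (s + (α + ω + β)) + u (s + α))]

end IsAngleParam

lemma cos_le_half {d : ℝ} (h0 : 0 ≤ d) (h1 : d ≤ 2 * π) (h : Real.cos d ≤ 1 / 2) :
    π / 3 ≤ d ∧ d ≤ 5 * π / 3 := by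
  have hpi := Real.pi_pos
  constructor <;> by_contra! hd
  · have := Real.cos_lt_cos_of_nonneg_of_le_pi h0 (by linarith) hd
    rw [Real.cos_pi_div_three] at this; linarith
  · have := Real.cos_lt_cos_of_nonneg_of_le_pi (x := 2 * π - d) (y := π / 3)
      (by linarith) (by linarith) (by linarith)
    rw [Real.cos_pi_div_three, Real.cos_two_pi_sub] at this; linarith

lemma cos_lt_half {d : ℝ} (h0 : 0 ≤ d) (h1 : d ≤ 2 * π) (h : Real.cos d < 1 / 2) :
    π / 3 < d ∧ d < 5 * π / 3 := by
  obtain ⟨h2, h3⟩ := cos_le_half h0 h1 h.le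
  refine ⟨h2.lt_of_ne ?_, h3.lt_of_ne ?_⟩
  · rintro rfl
    rw [Real.cos_pi_div_three] at h; exact lt_irrefl _ h
  · rintro rfl
    rw [show 5 * π / 3 = 2 * π - π / 3 by ring, Real.cos_two_pi_sub, Real.cos_pi_div_three] at h
    exact lt_irrefl _ h

lemma eq_pi_div_three_of_cos {d : ℝ} (h0 : 0 ≤ d) (h1 : d ≤ π) (h : Real.cos d = 1 / 2) :
    d = π / 3 := by
  have hpi := Real.pi_pos
  refine Real.injOn_cos ⟨h0, h1⟩ ⟨by linarith, by linarith⟩ ?_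
  rw [h, Real.cos_pi_div_three]

lemma exists_neighbor_notMem {P : Finset Pt} {X : Pt} (s : Finset Pt) (h : s.card < deg P X) :
    ∃ Y ∈ P, dist X Y = 1 ∧ Y ∉ s := by
  by_contra! hs
  have : deg P X ≤ s.card := by
    rw [deg, ← Set.ncard_coe_finset s]
    exact Set.ncard_le_ncard (fun Y hY => hs Y hY.1 hY.2) s.finite_toSet
  omega

namespace IsAngleParam

variable {u : ℝ → Pt} {P : Finset Pt}

/-- Two unit-neighbors of a point are at least `π / 3` apart in angle. -/
lemma angle_sep (hu : IsAngleParam u) (hP : PennyGP P) {X : Pt} {s t : ℝ} (hs : X + u s ∈ P)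
    (ht : X + u t ∈ P) (hst : s < t) (hts : t < s + 2 * π) :
    s + π / 3 ≤ t ∧ t ≤ s + 5 * π / 3 := by
  have hd := hu.dist_sq X t s
  have hsin : 0 < Real.sin ((t - s) / 2) :=
    Real.sin_pos_of_pos_of_lt_pi (by linarith) (by linarith)
  have hcos : Real.cos (t - s) = 1 - 2 * Real.sin ((t - s) / 2) ^ 2 := by
    rw [Real.sin_sq_eq_half_sub, show 2 * ((t - s) / 2) = t - s by ring]; ring
  have hne : X + u t ≠ X + u s := by
    intro h
    rw [h, dist_self] at hd
    nlinarith
  have h1 := hP.1 _ ht _ hs hne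
  have h2 : Real.cos (t - s) ≤ 1 / 2 := by nlinarith
  obtain ⟨h3, h4⟩ := cos_le_half (by linarith) (by linarith) h2
  constructor <;> linarith

/-- In a quadrilateral with three consecutive unit sides whose vertices belong to a penny
configuration, the two angles between these sides sum to at least `π`. -/
lemma trapezoid_le (hu : IsAngleParam u) (hP : PennyGP P) {X : Pt} {s p q : ℝ}
    (hC : X + u s + u (s + p) ∈ P) (hZ : X + u (s + q) ∈ P) (hp : 0 < p) (hp' : p < 2 * π / 3)
    (hq : 0 < q) : p ≤ q := by
  have hpi := Real.pi_pos
  have hne : X + u s + u (s + p) ≠ X + u (s + q) := by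
    intro h
    have h1 := hu.dist_base X (s + q)
    have h2 := hu.dist_sq (X + u s) (s + π) (s + p)
    rw [hu.add_pi, add_neg_cancel_right, h, h1,
      show s + π - (s + p) = π - p by ring] at h2
    have := eq_pi_div_three_of_cos (d := π - p) (by linarith) (by linarith) (by linarith)
    linarith
  have h1 := hP.1 _ hC _ hZ hne
  have h2 := hu.trapezoid_dist_sq X s p q
  by_contra! hqp
  have c1 : 0 < Real.cos (p / 2) := Real.cos_pos_of_mem_Ioo ⟨by linarith, by linarith⟩
  have c2 : 0 < Real.sin (q / 2) := Real.sin_pos_of_pos_of_lt_pi (by linarith) (by linarith)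
  have c3 : Real.sin ((q - p) / 2) < 0 :=
    Real.sin_neg_of_neg_of_neg_pi_lt (by linarith) (by linarith)
  nlinarith [mul_neg_of_pos_of_neg (mul_pos c1 c2) c3]

lemma trapezoid_eq (hu : IsAngleParam u) {X : Pt} {s p q : ℝ}
    (h : dist (X + u s + u (s + p)) (X + u (s + q)) = 1) (hp : 0 < p) (hp' : p < π)
    (hq : 0 < q) (hq' : q < 2 * π) : p = q := by
  have h2 := hu.trapezoid_dist_sq X s p q
  rw [h] at h2
  have c1 : 0 < Real.cos (p / 2) := Real.cos_pos_of_mem_Ioo ⟨by linarith, by linarith⟩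
  have c2 : 0 < Real.sin (q / 2) := Real.sin_pos_of_pos_of_lt_pi (by linarith) (by linarith)
  have c3 : Real.sin ((q - p) / 2) = 0 := by
    have : Real.cos (p / 2) * Real.sin (q / 2) * Real.sin ((q - p) / 2) = 0 := by linarith
    exact (mul_eq_zero.mp this).resolve_left (mul_pos c1 c2).ne'
  have := (Real.sin_eq_zero_iff_of_lt_of_lt (by linarith) (by linarith)).mp c3
  linarith

end IsAngleParam

/-- Around `B` there are two equilateral triangles of `P`, at angles `g` and `h` measured from
the ray in direction `u 0`, with all other consecutive angles larger than `π / 3`. -/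
structure TwoTriangles (P : Finset Pt) (B : Pt) (u : ℝ → Pt) (g h : ℝ) : Prop where
  lt_g : π / 3 < g
  g_lt : g + 2 * π / 3 < h
  h_lt : h < 4 * π / 3
  mem₁ : B + u g ∈ P
  mem₂ : B + u (g + π / 3) ∈ P
  mem₃ : B + u h ∈ P
  mem₄ : B + u (h + π / 3) ∈ P
  deg₁ : 5 ≤ deg P (B + u g)
  deg₂ : 5 ≤ deg P (B + u (g + π / 3))

lemma exists_twoTriangles {P : Finset Pt} (hP : PennyGP P) {A B : Pt} {u : ℝ → Pt}
    (hu : IsAngleParam u) (hA : A ∈ P) (hB : B ∈ P) (hAB : A = B + u 0) (hdA : deg P A = 4)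
    (hI : deg P B = 5 ∧ ¬ Unpopular P B ∧
      (∀ C ∈ P, dist B C = 1 → C ≠ A → dist A C ≠ 1) ∧
      ∃ C₁ ∈ P, ∃ C₂ ∈ P, ∃ C₃ ∈ P, ∃ C₄ ∈ P,
        List.Pairwise (· ≠ ·) [A, C₁, C₂, C₃, C₄] ∧
        dist B C₁ = 1 ∧ dist B C₂ = 1 ∧ dist B C₃ = 1 ∧ dist B C₄ = 1 ∧
        dist C₁ C₂ = 1 ∧ dist C₃ C₄ = 1) :
    ∃ g h, TwoTriangles P B u g h := by
  have hpi := Real.pi_pos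
  obtain ⟨hdB, hpop, hno, C₁, h₁, C₂, h₂, C₃, h₃, C₄, h₄, hpw, d₁, d₂, d₃, d₄, d₁₂, d₃₄⟩ := hI
  have hBA : dist B A = 1 := hAB ▸ hu.dist_base B 0
  have hdeg : ∀ C ∈ P, dist B C = 1 → C ≠ A → 5 ≤ deg P C := by
    intro C hC hBC hCA
    by_contra! hlt
    refine hpop (Or.inr ?_)
    by_cases h3 : deg P C ≤ 3
    · exact Or.inl ⟨hdB, C, hC, hBC, h3⟩
    · exact Or.inr ⟨hdB, C, hC, A, hA, hCA, hBC, hBA, by omega, hdA⟩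
  have hang : ∀ C ∈ P, dist B C = 1 → C ≠ A →
      ∃ t, π / 3 < t ∧ t < 5 * π / 3 ∧ C = B + u t := by
    intro C hC hBC hCA
    obtain ⟨t, ht0, ht1, rfl⟩ := hu.exists_eq hBC 0
    have hd := hu.dist_sq B t 0
    rw [← hAB, dist_comm, sub_zero] at hd
    have h1 := hP.1 _ hA _ hC (Ne.symm hCA)
    have h2 : 1 < dist A (B + u t) := lt_of_le_of_ne h1 (Ne.symm (hno _ hC hBC hCA))
    have := cos_lt_half ht0 (by linarith) (by nlinarith)
    exact ⟨t, this.1, this.2, rfl⟩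
  have hpair : ∀ C ∈ P, ∀ D ∈ P, dist B C = 1 → dist B D = 1 → C ≠ A → D ≠ A → dist C D = 1 →
      ∃ a, π / 3 < a ∧ a < 4 * π / 3 ∧
        (C = B + u a ∧ D = B + u (a + π / 3) ∨ D = B + u a ∧ C = B + u (a + π / 3)) := by
    intro C hC D hD hBC hBD hCA hDA hCD
    obtain ⟨s, hs0, hs1, rfl⟩ := hang C hC hBC hCA
    obtain ⟨t, ht0, ht1, rfl⟩ := hang D hD hBD hDA
    have hd := hu.dist_sq B s t
    rw [hCD] at hd
    have hcos : Real.cos (s - t) = 1 / 2 := by linarith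
    rcases le_total s t with hst | hst
    · rw [← Real.cos_neg] at hcos
      have h1 := cos_le_half (d := -(s - t)) (by linarith) (by linarith) hcos.le
      have h2 : -(s - t) = π / 3 := by
        by_cases h : -(s - t) ≤ π
        · exact eq_pi_div_three_of_cos (by linarith) h hcos
        · have := eq_pi_div_three_of_cos (d := 2 * π - -(s - t)) (by linarith) (by linarith)
            (by rw [Real.cos_two_pi_sub, hcos])
          linarith
      obtain rfl : t = s + π / 3 := by linarith
      exact ⟨s, hs0, by linarith, Or.inl ⟨rfl, rfl⟩⟩
    · have h2 : s - t = π / 3 := by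
        by_cases h : s - t ≤ π
        · exact eq_pi_div_three_of_cos (by linarith) h hcos
        · have := eq_pi_div_three_of_cos (d := 2 * π - (s - t)) (by linarith) (by linarith)
            (by rw [Real.cos_two_pi_sub, hcos])
          linarith
      obtain rfl : s = t + π / 3 := by linarith
      exact ⟨t, ht0, by linarith, Or.inr ⟨rfl, rfl⟩⟩
  simp only [List.pairwise_cons, List.mem_cons, List.not_mem_nil, or_false, forall_eq_or_imp,
    forall_eq, false_imp_iff, implies_true, List.Pairwise.nil, and_true] at hpw
  obtain ⟨⟨n₁, n₂, n₃, n₄⟩, ⟨-, n₁₃, n₁₄⟩, ⟨n₂₃, n₂₄⟩, -⟩ := hpw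
  obtain ⟨a, ha0, ha1, ha⟩ := hpair C₁ h₁ C₂ h₂ d₁ d₂ n₁.symm n₂.symm d₁₂
  obtain ⟨b, hb0, hb1, hb⟩ := hpair C₃ h₃ C₄ h₄ d₃ d₄ n₃.symm n₄.symm d₃₄
  have hmain : ∀ a b, π / 3 < a → b < 4 * π / 3 → a ≤ b →
      (B + u a ∈ P ∧ B + u a ≠ A) → (B + u (a + π / 3) ∈ P ∧ B + u (a + π / 3) ≠ A) →
      (B + u b ∈ P ∧ B + u b ≠ A) → (B + u (b + π / 3) ∈ P ∧ B + u (b + π / 3) ≠ A) →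
      B + u a ≠ B + u b → B + u (a + π / 3) ≠ B + u b → TwoTriangles P B u a b := by
    intro a b ha hb hab p1 p2 p3 p4 hne hne'
    have hlt : a < b := lt_of_le_of_ne hab (by rintro rfl; exact hne rfl)
    have s1 := hu.angle_sep hP p1.1 p3.1 hlt (by linarith)
    have hlt' : a + π / 3 < b := lt_of_le_of_ne s1.1 (by rintro rfl; exact hne' rfl)
    have s2 := hu.angle_sep hP p2.1 p3.1 hlt' (by linarith)
    refine ⟨ha, lt_of_le_of_ne (by linarith) ?_, hb, p1.1, p2.1, p3.1, p4.1,
      hdeg _ p1.1 (hu.dist_base B _) p1.2, hdeg _ p2.1 (hu.dist_base B _) p2.2⟩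
    intro hab'
    have e : B + u (b + π / 3) = B - u a := by
      rw [show b + π / 3 = a + π by linarith, hu.add_pi, sub_eq_add_neg]
    have q1 := hu.dist_base B a
    have q2 := hu.dist_base B (b + π / 3)
    refine hP.2 B hB _ p1.1 _ p4.1 ?_ ?_ ?_ ?_
    · intro h; rw [← h, dist_self] at q1; exact zero_ne_one q1
    · intro h; rw [← h, dist_self] at q2; exact zero_ne_one q2
    · intro h
      have := hu.dist_sq B (b + π / 3) a
      rw [h, dist_self, show b + π / 3 - a = π by linarith, Real.cos_pi] at this
      norm_num at this
    · rw [e, collinear_iff_exists_forall_eq_smul_vadd]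
      refine ⟨B, u a, ?_⟩
      simp only [Set.mem_insert_iff, Set.mem_singleton_iff, forall_eq_or_imp, forall_eq]
      refine ⟨⟨0, by simp⟩, ⟨1, by simp [add_comm]⟩, ⟨-1, ?_⟩⟩
      simp [sub_eq_add_neg, add_comm]
  rcases le_total a b with hab | hab
  · refine ⟨a, b, ?_⟩
    rcases ha with ⟨rfl, rfl⟩ | ⟨rfl, rfl⟩ <;> rcases hb with ⟨rfl, rfl⟩ | ⟨rfl, rfl⟩ <;>
    · apply hmain a b ha0 hb1 hab <;>
        first
        | (constructor <;> first | assumption | (apply Ne.symm; assumption))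
        | assumption
  · refine ⟨b, a, ?_⟩
    rcases ha with ⟨rfl, rfl⟩ | ⟨rfl, rfl⟩ <;> rcases hb with ⟨rfl, rfl⟩ | ⟨rfl, rfl⟩ <;>
    · apply hmain b a hb0 ha1 hab <;>
        first
        | (constructor <;> first | assumption | (apply Ne.symm; assumption))
        | (apply Ne.symm; assumption)

/-- A unit-neighbor of the first triangle vertex lying close to the direction of the reflected
apex has to be the reflected apex itself. -/
lemma TwoTriangles.apex_offset_eq_zero {P : Finset Pt} (hP : PennyGP P) {B : Pt} {u : ℝ → Pt}
    (hu : IsAngleParam u) {g h x : ℝ} (T : TwoTriangles P B u g h) (hx : 0 ≤ x)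
    (hxg : x ≤ g - π / 3) (hG : B + u g + u (g + π / 3 - x) ∈ P) : x = 0 := by
  have hpi := Real.pi_pos
  obtain ⟨hg, hgh, hh, m₁, m₂, m₃, -, -, hdeg⟩ := T
  set C := B + u (g + π / 3) with hC
  have e₁ : B + u g = C + u (g - π / 3) := by
    have h1 := hu.add_pi_div_three g
    have h2 := hu.add_pi (g - π / 3)
    rw [show g - π / 3 + π = g + 2 * π / 3 by ring] at h2
    rw [hC, h1, h2]; abel
  have eB : B = C + u (g + 4 * π / 3) := by
    rw [show g + 4 * π / 3 = g + π / 3 + π by ring, hu.add_pi, hC]; abel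
  have hnear : ∀ Y ∈ P, dist C Y = 1 → Y ≠ B → Y ≠ B + u g →
      ∃ v, π / 3 ≤ v ∧ v ≤ π / 3 + (h - g) ∧ Y = C + u (g - π / 3 + v) := by
    intro Y hY hCY hYB hY₁
    obtain ⟨t, ht0, ht1, rfl⟩ := hu.exists_eq hCY (g - π / 3)
    have hlt : g - π / 3 < t := lt_of_le_of_ne ht0 (by rintro rfl; exact hY₁ e₁.symm)
    have hsep := hu.angle_sep hP (e₁ ▸ m₁) hY hlt ht1
    have hne : t ≠ g + 4 * π / 3 := by rintro rfl; exact hYB eB.symm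
    have hlt' : t < g + 4 * π / 3 := lt_of_le_of_ne (by linarith) hne
    refine ⟨t - (g - π / 3), by linarith, ?_, by congr 2; ring⟩
    have := hu.neg.trapezoid_le hP (X := C) (s := -(g + 4 * π / 3)) (p := g - h + 4 * π / 3)
      (q := g + 4 * π / 3 - t)
      (by
        rw [neg_neg, ← eB, show -(-(g + 4 * π / 3) + (g - h + 4 * π / 3)) = h by ring]
        exact m₃)
      (by
        rw [show -(-(g + 4 * π / 3) + (g + 4 * π / 3 - t)) = t by ring]
        exact hY)
      (by linarith) (by linarith) (by linarith)
    linarith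
  have hclose : ∃ v, π / 3 ≤ v ∧ v ≤ h - g - π / 3 ∧ C + u (g - π / 3 + v) ∈ P := by
    obtain ⟨Y₁, hY₁, dY₁, nY₁⟩ := exists_neighbor_notMem {B, B + u g}
      (lt_of_le_of_lt Finset.card_le_two (by omega : 2 < deg P C))
    obtain ⟨Y₂, hY₂, dY₂, nY₂⟩ := exists_neighbor_notMem {B, B + u g, Y₁}
      (lt_of_le_of_lt Finset.card_le_three (by omega : 3 < deg P C))
    obtain ⟨Y₃, hY₃, dY₃, nY₃⟩ := exists_neighbor_notMem {B, B + u g, Y₁, Y₂}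
      (lt_of_le_of_lt Finset.card_le_four (by omega : 4 < deg P C))
    simp only [Finset.mem_insert, Finset.mem_singleton, not_or] at nY₁ nY₂ nY₃
    obtain ⟨v₁, l₁, r₁, rfl⟩ := hnear Y₁ hY₁ dY₁ nY₁.1 nY₁.2
    obtain ⟨v₂, l₂, r₂, rfl⟩ := hnear Y₂ hY₂ dY₂ nY₂.1 nY₂.2.1
    obtain ⟨v₃, l₃, r₃, rfl⟩ := hnear Y₃ hY₃ dY₃ nY₃.1 nY₃.2.1
    have hsep : ∀ v w, π / 3 ≤ v → v ≤ π / 3 + (h - g) → π / 3 ≤ w → w ≤ π / 3 + (h - g) →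
        C + u (g - π / 3 + v) ∈ P → C + u (g - π / 3 + w) ∈ P →
        C + u (g - π / 3 + w) ≠ C + u (g - π / 3 + v) → v + π / 3 ≤ w ∨ w + π / 3 ≤ v := by
      intro v w hv hv' hw hw' hvP hwP hne
      rcases lt_trichotomy v w with hlt | rfl | hlt
      · have := (hu.angle_sep hP hvP hwP (by linarith) (by linarith)).1
        left; linarith
      · exact absurd rfl hne
      · have := (hu.angle_sep hP hwP hvP (by linarith) (by linarith)).1
        right; linarith
    by_contra! hfar
    have f₁ : h - g - π / 3 < v₁ := by by_contra! h'; exact hfar v₁ l₁ h' hY₁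
    have f₂ : h - g - π / 3 < v₂ := by by_contra! h'; exact hfar v₂ l₂ h' hY₂
    have f₃ : h - g - π / 3 < v₃ := by by_contra! h'; exact hfar v₃ l₃ h' hY₃
    rcases hsep v₁ v₂ l₁ r₁ l₂ r₂ hY₁ hY₂ nY₂.2.2 with a | a <;>
    rcases hsep v₁ v₃ l₁ r₁ l₃ r₃ hY₁ hY₃ nY₃.2.2.1 with b | b <;>
    rcases hsep v₂ v₃ l₂ r₂ l₃ r₃ hY₂ hY₃ nY₃.2.2.2 with c | c <;> linarith
  obtain ⟨v, hv, hv', hY⟩ := hclose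
  have e₂ : B + u g + u (g + 2 * π / 3) = C := by
    rw [hC, hu.add_pi_div_three g, add_assoc]
  rcases hv.eq_or_lt with rfl | hv
  · by_contra hx0
    have hxpos : 0 < x := lt_of_le_of_ne hx (Ne.symm hx0)
    have e₃ : C + u (g - π / 3 + π / 3) = B + u g + u (g + π / 3) := by
      rw [sub_add_cancel, hC]; abel
    have := hu.angle_sep hP hG (e₃ ▸ hY) (by linarith) (by linarith)
    linarith
  · have := hu.neg.trapezoid_le hP (X := B + u g) (s := -(g + 2 * π / 3)) (p := π - v)
      (q := π / 3 + x)
      (by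
        rw [neg_neg, e₂, show -(-(g + 2 * π / 3) + (π - v)) = g - π / 3 + v by ring]
        exact hY)
      (by
        rw [show -(-(g + 2 * π / 3) + (π / 3 + x)) = g + π / 3 - x by ring]
        exact hG)
      (by linarith) (by linarith) (by linarith)
    linarith

/-- Angular form of the impossibility of two consecutive edges of Type I at a vertex of
degree 4. -/
lemma false_of_consecutive {P : Finset Pt} (hP : PennyGP P) {A : Pt} (hA : A ∈ P)
    (hdA : deg P A = 4) {b₁ b₂ b₃ b₄ : ℝ} (h₁₂ : b₁ < b₂) (h₂₃ : b₂ < b₃) (h₃₄ : b₃ < b₄)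
    (h₄₁ : b₄ < b₁ + 2 * π) (m₁ : A + unitVec b₁ ∈ P) (m₂ : A + unitVec b₂ ∈ P)
    (m₃ : A + unitVec b₃ ∈ P) (m₄ : A + unitVec b₄ ∈ P)
    (htypeI : ∀ B ∈ ({A + unitVec b₁, A + unitVec b₂} : Set Pt),
      deg P B = 5 ∧ ¬ Unpopular P B ∧
      (∀ C ∈ P, dist B C = 1 → C ≠ A → dist A C ≠ 1) ∧
      ∃ C₁ ∈ P, ∃ C₂ ∈ P, ∃ C₃ ∈ P, ∃ C₄ ∈ P,
        List.Pairwise (· ≠ ·) [A, C₁, C₂, C₃, C₄] ∧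
        dist B C₁ = 1 ∧ dist B C₂ = 1 ∧ dist B C₃ = 1 ∧ dist B C₄ = 1 ∧
        dist C₁ C₂ = 1 ∧ dist C₃ C₄ = 1) :
    False := by
  have hpi := Real.pi_pos
  set B₁ := A + unitVec b₁ with hB₁
  set B₂ := A + unitVec b₂ with hB₂
  have hu₁ := isAngleParam_sub (b₁ + π)
  have hu₂ := isAngleParam_add (b₂ + π)
  obtain ⟨g, h, T⟩ := exists_twoTriangles hP hu₁ hA m₁
    (by simp only [sub_zero]; rw [unitVec_add_pi, hB₁]; abel) hdA (htypeI B₁ (by simp))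
  obtain ⟨g', h', T'⟩ := exists_twoTriangles hP hu₂ hA m₂
    (by simp only [add_zero]; rw [unitVec_add_pi, hB₂]; abel) hdA (htypeI B₂ (by simp))
  have hT := T
  have hT' := T'
  obtain ⟨hg, hgh, hh, n₁, n₂, n₃, n₄, hd₁, -⟩ := T
  obtain ⟨hg', hgh', hh', n₁', n₂', n₃', n₄', -, -⟩ := T'
  have hp := isAngleParam_add 0
  have hm := isAngleParam_sub 0
  simp only [zero_add] at hp
  simp only [zero_sub] at hm
  have t₄₁ : h - 2 * π / 3 ≤ b₁ + 2 * π - b₄ := by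
    refine hm.trapezoid_le hP (X := A) (s := -b₁) ?_ ?_ (by linarith) (by linarith)
      (by linarith)
    · convert n₄ using 2
      · rw [neg_neg]
      · congr 1; ring
    · convert m₄ using 2
      rw [← unitVec_sub_two_pi (b₄)]; congr 1; ring
  have t₂₃ : h' - 2 * π / 3 ≤ b₃ - b₂ := by
    refine hp.trapezoid_le hP (X := A) (s := b₂) ?_ ?_ (by linarith) (by linarith)
      (by linarith)
    · convert n₄' using 2
      rw [← unitVec_sub_two_pi (b₂ + π + (h' + π / 3))]; congr 1; ring
    · convert m₃ using 2
      congr 1; ring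
  have t₁₂ : π - g ≤ b₂ - b₁ := by
    refine hp.trapezoid_le hP (X := A) (s := b₁) ?_ ?_ (by linarith) (by linarith)
      (by linarith)
    · convert n₁ using 2
      congr 1; ring
    · convert m₂ using 2
      congr 1; ring
  have t₁₂' : π - g' ≤ b₂ - b₁ := by
    refine hm.trapezoid_le hP (X := A) (s := -b₂) ?_ ?_ (by linarith) (by linarith)
      (by linarith)
    · convert n₁' using 2
      · rw [neg_neg]
      · rw [← unitVec_sub_two_pi (b₂ + π + g')]; congr 1; ring
    · convert m₁ using 2
      congr 1; ring
  have t₃₄ := (hp.angle_sep hP m₃ m₄ h₃₄ (by linarith)).1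
  have hC : B₁ + unitVec (b₁ + π - g) = B₂ + unitVec (b₂ + π + g') := by
    by_contra hne
    have h1 := hP.1 _ n₁ _ n₁' hne
    have h2 := hp.pentagon_dist_lt_one A b₁ (α := b₂ - b₁ + g' - π)
      (ω := 2 * π - (b₂ - b₁) - g - g') (β := b₂ - b₁ + g - π) (by linarith) (by linarith)
      (by linarith) (by linarith) (by linarith)
    rw [show b₁ + (b₂ - b₁ + g' - π + (2 * π - (b₂ - b₁) - g - g')) = b₁ + π - g by ring,
      show b₁ + (b₂ - b₁ + g' - π + (2 * π - (b₂ - b₁) - g - g') + (b₂ - b₁ + g - π)) = b₂ by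
        ring,
      show b₁ + (b₂ - b₁ + g' - π) = b₂ + π + g' - 2 * π by ring, unitVec_sub_two_pi] at h2
    linarith
  have hag : π - g = b₂ - b₁ := by
    refine hp.trapezoid_eq (X := A) (s := b₁) ?_ (by linarith) (by linarith) (by linarith)
      (by linarith)
    rw [show b₁ + (π - g) = b₁ + π - g by ring, add_sub_cancel, ← hB₁, ← hB₂, hC, dist_comm]
    exact hp.dist_base _ _
  have hag' : π - g' = b₂ - b₁ := by
    refine hm.trapezoid_eq (X := A) (s := -b₂) ?_ (by linarith) (by linarith) (by linarith)
      (by linarith)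
    rw [show -(-b₂ + (π - g')) = b₂ + π + g' - 2 * π by ring, unitVec_sub_two_pi,
      show -(-b₂ + (b₂ - b₁)) = b₁ by ring, neg_neg, ← hB₁, ← hB₂, ← hC, dist_comm]
    exact hp.dist_base _ _
  obtain rfl : g = π - (b₂ - b₁) := by linarith
  obtain rfl : g' = π - (b₂ - b₁) := by linarith
  set C := B₁ + unitVec (b₁ + π - (π - (b₂ - b₁))) with hCdef
  have eC : C = B₁ + unitVec b₂ := by rw [hCdef]; congr 2; ring
  have eC' : C = B₂ + unitVec b₁ := by rw [eC, hB₁, hB₂]; abel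
  have eB₁ : B₁ = C + unitVec (b₂ + π) := by rw [eC, unitVec_add_pi]; abel
  have eB₂ : B₂ = C + unitVec (b₁ + π) := by rw [eC', unitVec_add_pi]; abel
  have eD : B₁ + unitVec (b₁ + π - (π - (b₂ - b₁) + π / 3)) = C + unitVec (b₂ - 2 * π / 3) := by
    rw [show b₁ + π - (π - (b₂ - b₁) + π / 3) = b₂ - π / 3 by ring, eC,
      unitVec_sub_pi_div_three, ← add_assoc]
  have eD' : B₂ + unitVec (b₂ + π + (π - (b₂ - b₁) + π / 3)) =
      C + unitVec (b₁ + 2 * π / 3) := by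
    rw [show b₂ + π + (π - (b₂ - b₁) + π / 3) = b₁ + π / 3 + 2 * π by ring, eC',
      unitVec_add_two_pi, unitVec_add_pi_div_three, ← add_assoc]
  obtain ⟨G, hG, dG, nG⟩ := exists_neighbor_notMem
    {B₁, B₂, C + unitVec (b₂ - 2 * π / 3), C + unitVec (b₁ + 2 * π / 3)}
    (lt_of_le_of_lt Finset.card_le_four (by omega : 4 < deg P C))
  simp only [Finset.mem_insert, Finset.mem_singleton, not_or] at nG
  obtain ⟨k₁, k₂, k₃, k₄⟩ := nG
  obtain ⟨κ, hκ, hκ', rfl⟩ := hp.exists_eq dG (b₂ - 2 * π / 3)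
  have c₃ := hp.angle_sep hP (eD ▸ n₂) hG
    (lt_of_le_of_ne hκ (by rintro rfl; exact k₃ rfl)) hκ'
  have c₁ : κ + π / 3 ≤ b₂ + π := by
    have hne : κ ≠ b₂ + π := by rintro rfl; exact k₁ eB₁.symm
    have := (hp.angle_sep hP hG (eB₁ ▸ m₁) (lt_of_le_of_ne (by linarith) hne) (by linarith)).1
    exact this
  have c₂ : κ + π / 3 ≤ b₁ + π := by
    rcases lt_trichotomy κ (b₁ + π) with hlt | rfl | hlt
    · exact (hp.angle_sep hP hG (eB₂ ▸ m₂) hlt (by linarith)).1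
    · exact absurd eB₂.symm k₂
    · have := (hp.angle_sep hP (eB₂ ▸ m₂) hG hlt (by linarith)).1
      linarith
  have c₄ : κ + π / 3 ≤ b₁ + 2 * π / 3 := by
    have hne : κ ≠ b₁ + 2 * π / 3 := by rintro rfl; exact k₄ rfl
    exact (hp.angle_sep hP hG (eD' ▸ n₂') (lt_of_le_of_ne (by linarith) hne) (by linarith)).1
  have x₁ := hT.apex_offset_eq_zero hP hu₁ (x := κ - (b₂ - π / 3)) (by linarith)
    (by linarith) (by convert hG using 3; ring)
  have x₂ := hT'.apex_offset_eq_zero hP hu₂ (x := b₁ + π / 3 - κ) (by linarith)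
    (by linarith) (by
      convert hG using 2
      · exact hC.symm
      · rw [← unitVec_add_two_pi κ]; congr 1; ring)
  linarith

lemma AngOrder.exists_angles {A W₁ W₂ W₃ W₄ : Pt} (h : AngOrder A [W₁, W₂, W₃, W₄])
    (d₁ : dist A W₁ = 1) (d₂ : dist A W₂ = 1) (d₃ : dist A W₃ = 1) (d₄ : dist A W₄ = 1) :
    ∃ b₁ b₂ b₃ b₄ : ℝ, b₁ < b₂ ∧ b₂ < b₃ ∧ b₃ < b₄ ∧ b₄ < b₁ + 2 * π ∧
      W₁ = A + unitVec b₁ ∧ W₂ = A + unitVec b₂ ∧ W₃ = A + unitVec b₃ ∧ W₄ = A + unitVec b₄ := by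
  obtain ⟨θ, r, hr, hmono, hlt, hW⟩ := h
  have hray : ∀ (W : Pt) (t s : ℝ), 0 < s → dist A W = 1 →
      W = A + s • (EuclideanSpace.equiv (Fin 2) ℝ).symm ![Real.cos t, Real.sin t] →
      W = A + unitVec t := by
    rintro W t s hs hd rfl
    have e : (EuclideanSpace.equiv (Fin 2) ℝ).symm ![Real.cos t, Real.sin t] = unitVec t := rfl
    have hn : ‖unitVec t‖ = 1 := by
      have := (isAngleParam_add 0).dist_base A t
      rwa [zero_add, dist_self_add_right] at this
    rw [e, dist_self_add_right, norm_smul, hn, mul_one, Real.norm_of_nonneg hs.le] at hd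
    rw [e, hd, one_smul]
  refine ⟨θ 0, θ 1, θ 2, θ 3, hmono (show (0 : Fin 4) < 1 by decide),
    hmono (show (1 : Fin 4) < 2 by decide), hmono (show (2 : Fin 4) < 3 by decide), ?_,
    hray _ _ _ (hr 0) d₁ (hW 0), hray _ _ _ (hr 1) d₂ (hW 1), hray _ _ _ (hr 2) d₃ (hW 2),
    hray _ _ _ (hr 3) d₄ (hW 3)⟩
  have := hlt 0 3
  linarith

/-- Two cyclically consecutive edges at a vertex of degree 4 cannot both be of
Type I: if `A` has degree exactly 4 with unit-neighbors `B₁, B₂, B₃, B₄`, where `B₁`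
and `B₂` are consecutive in the cyclic angular order around `A`, and for `i = 1, 2`
the vertex `Bᵢ` has degree 5, is popular, has no unit-neighbor other than `A` at
unit distance from `A`, and its four unit-neighbors other than `A` split into two
pairs of points at unit distance, then we reach a contradiction. -/
theorem no_two_consecutive_type_I_edges (P : Finset Pt) (hP : PennyGP P)
    (A B₁ B₂ B₃ B₄ : Pt) (hA : A ∈ P)
    (hB₁ : B₁ ∈ P) (hB₂ : B₂ ∈ P) (hB₃ : B₃ ∈ P) (hB₄ : B₄ ∈ P)
    (hne : List.Pairwise (· ≠ ·) [B₁, B₂, B₃, B₄])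
    (hd₁ : dist A B₁ = 1) (hd₂ : dist A B₂ = 1)
    (hd₃ : dist A B₃ = 1) (hd₄ : dist A B₄ = 1)
    (hdA : deg P A = 4)
    (hconsec : AngOrder A [B₁, B₂, B₃, B₄] ∨ AngOrder A [B₁, B₂, B₄, B₃] ∨
      AngOrder A [B₂, B₁, B₃, B₄] ∨ AngOrder A [B₂, B₁, B₄, B₃])
    (htypeI : ∀ B ∈ ({B₁, B₂} : Set Pt),
      deg P B = 5 ∧ ¬ Unpopular P B ∧
      (∀ C ∈ P, dist B C = 1 → C ≠ A → dist A C ≠ 1) ∧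
      ∃ C₁ ∈ P, ∃ C₂ ∈ P, ∃ C₃ ∈ P, ∃ C₄ ∈ P,
        List.Pairwise (· ≠ ·) [A, C₁, C₂, C₃, C₄] ∧
        dist B C₁ = 1 ∧ dist B C₂ = 1 ∧ dist B C₃ = 1 ∧ dist B C₄ = 1 ∧
        dist C₁ C₂ = 1 ∧ dist C₃ C₄ = 1) :
    False := by
  have hsymm : ({B₂, B₁} : Set Pt) = {B₁, B₂} := Set.pair_comm _ _
  rcases hconsec with h | h | h | h
  · obtain ⟨b₁, b₂, b₃, b₄, l₁, l₂, l₃, l₄, rfl, rfl, rfl, rfl⟩ := h.exists_angles hd₁ hd₂ hd₃ hd₄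
    exact false_of_consecutive hP hA hdA l₁ l₂ l₃ l₄ hB₁ hB₂ hB₃ hB₄ htypeI
  · obtain ⟨b₁, b₂, b₃, b₄, l₁, l₂, l₃, l₄, rfl, rfl, rfl, rfl⟩ := h.exists_angles hd₁ hd₂ hd₄ hd₃
    exact false_of_consecutive hP hA hdA l₁ l₂ l₃ l₄ hB₁ hB₂ hB₄ hB₃ htypeI
  · obtain ⟨b₁, b₂, b₃, b₄, l₁, l₂, l₃, l₄, rfl, rfl, rfl, rfl⟩ := h.exists_angles hd₂ hd₁ hd₃ hd₄
    exact false_of_consecutive hP hA hdA l₁ l₂ l₃ l₄ hB₂ hB₁ hB₃ hB₄ (hsymm ▸ htypeI)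
  · obtain ⟨b₁, b₂, b₃, b₄, l₁, l₂, l₃, l₄, rfl, rfl, rfl, rfl⟩ := h.exists_angles hd₂ hd₁ hd₄ hd₃
    exact false_of_consecutive hP hA hdA l₁ l₂ l₃ l₄ hB₂ hB₁ hB₄ hB₃ (hsymm ▸ htypeI)
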